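/- Let n be a positive integer. The limit wave speed c₀(h) = 1/(A_n(h)/A_0(h) − 1) is well defined (since A_n(h)/A_0(h) > 1) and is strictly increasing as a function of h on the interval (p₁, 0), and for every h ∈ (p₁, 0) it satisfies the strict bounds 1/n < c₀(h) < (3n+4)/(2n² + 3n). -/

import Mathlib

open MeasureTheory

section Lemmas

open Set

/-- A nonnegative integrable function which is positive on an initial subinterval has positive
integral. -/
theorem setIntegral_pos_of_pos_left {p q T : ℝ} {k : ℝ → ℝ} (hT : p < T) (hTq : T ≤ q)
    (hk : ∀ s ∈ Ioo p T, 0 < k s) (hk0 : ∀ s ∈ Ioo p q, 0 ≤ k s)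
    (ik : IntegrableOn k (Ioo p q)) : 0 < ∫ s in Ioo p q, k s := by
  rw [setIntegral_pos_iff_support_of_nonneg_ae _ ik]
  · have : Ioo p T ⊆ Function.support k ∩ Ioo p q := fun s hs =>
      ⟨(hk s hs).ne', Ioo_subset_Ioo_right hTq hs⟩
    refine lt_of_lt_of_le ?_ (measure_mono this)
    simp [hT]
  · filter_upwards [ae_restrict_mem measurableSet_Ioo] with s hs using hk0 s hs

/-- Monotonicity of a ratio of integrals against the kernels `√(2 (h - s))`, for densities
whose pointwise ratio is strictly increasing. -/
theorem ratio_lt_of_strictMonoOn {p q h₁ h₂ : ℝ} (hp : p < h₁) (h₁₂ : h₁ < h₂) (hq : h₂ ≤ q)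
    {e g : ℝ → ℝ} (hg : ∀ s ∈ Ioo p q, 0 < g s)
    (hmono : StrictMonoOn (fun s => e s / g s) (Ioo p q))
    (ie₁ : IntegrableOn (fun s => e s * √(2 * (h₁ - s))) (Ioo p q))
    (ie₂ : IntegrableOn (fun s => e s * √(2 * (h₂ - s))) (Ioo p q))
    (ig₁ : IntegrableOn (fun s => g s * √(2 * (h₁ - s))) (Ioo p q))
    (ig₂ : IntegrableOn (fun s => g s * √(2 * (h₂ - s))) (Ioo p q)) :
    (∫ s in Ioo p q, e s * √(2 * (h₁ - s))) / (∫ s in Ioo p q, g s * √(2 * (h₁ - s))) <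
      (∫ s in Ioo p q, e s * √(2 * (h₂ - s))) / ∫ s in Ioo p q, g s * √(2 * (h₂ - s)) := by
  set c := (∫ s in Ioo p q, e s * √(2 * (h₁ - s))) / ∫ s in Ioo p q, g s * √(2 * (h₁ - s))
    with hc
  have hpos : ∀ h, p < h → h ≤ q → IntegrableOn (fun s => g s * √(2 * (h - s))) (Ioo p q) →
      0 < ∫ s in Ioo p q, g s * √(2 * (h - s)) := fun h hh hhq ih =>
    setIntegral_pos_of_pos_left hh hhq (fun s hs => mul_pos (hg s ⟨hs.1, by linarith [hs.2]⟩)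
      (Real.sqrt_pos.2 (by linarith [hs.2])))
      (fun s hs => mul_nonneg (hg s hs).le (Real.sqrt_nonneg _)) ih
  have hpos₁ := hpos h₁ hp (by linarith) ig₁
  have hpos₂ := hpos h₂ (by linarith) hq ig₂
  have hz : ∫ s in Ioo p q, (e s * √(2 * (h₁ - s)) - c * (g s * √(2 * (h₁ - s)))) = 0 := by
    rw [integral_sub ie₁ (ig₁.const_mul c), integral_const_mul, hc]
    field_simp
    ring
  have iz : IntegrableOn (fun s => e s * √(2 * (h₁ - s)) - c * (g s * √(2 * (h₁ - s))))
    (Ioo p q) := ie₁.sub (ig₁.const_mul c)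
  have K₁ : ∀ s, s < h₁ → 0 < √(2 * (h₁ - s)) := fun s hs => Real.sqrt_pos.2 (by linarith)
  have he : ∀ s ∈ Ioo p q, e s = e s / g s * g s := fun s hs => by
    have := (hg s hs).ne'
    field_simp
  -- the ratio `e / g` crosses the level `c` at some `t ∈ (p, h₁)`
  obtain ⟨t, ht, htl, htr⟩ : ∃ t ∈ Ioo p h₁, (∀ s ∈ Ioo p q, s < t → e s / g s < c) ∧
      ∀ s ∈ Ioo p q, t < s → c < e s / g s := by
    let S := {s | s ∈ Ioo p q ∧ e s / g s ≤ c}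
    have bdd : BddAbove S := ⟨q, fun s hs => hs.1.2.le⟩
    have ne : S.Nonempty := by
      by_contra hS
      have hS' : ∀ s ∈ Ioo p q, c < e s / g s := by
        intro s hs
        by_contra hcon
        exact hS ⟨s, hs, not_lt.1 hcon⟩
      refine (setIntegral_pos_of_pos_left hp (by linarith) ?_ ?_ iz).ne' hz
      · intro s hs
        have hs' : s ∈ Ioo p q := ⟨hs.1, by linarith [hs.2]⟩
        have := mul_pos (mul_pos (sub_pos.2 (hS' s hs')) (hg s hs')) (K₁ s hs.2)
        rw [he s hs']; linarith
      · intro s hs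
        have := mul_nonneg (mul_pos (sub_pos.2 (hS' s hs)) (hg s hs)).le
          (Real.sqrt_nonneg (2 * (h₁ - s)))
        rw [he s hs]; linarith
    have hl : ∀ s ∈ Ioo p q, s < sSup S → e s / g s < c := by
      intro s hs hst
      obtain ⟨s', hs', hss'⟩ := exists_lt_of_lt_csSup ne hst
      exact (hmono hs hs'.1 hss').trans_le hs'.2
    have hr : ∀ s ∈ Ioo p q, sSup S < s → c < e s / g s := by
      intro s hs hst
      by_contra hcon
      exact absurd (le_csSup bdd (show s ∈ S from ⟨hs, not_lt.1 hcon⟩)) (not_le.2 hst)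
    refine ⟨sSup S, ⟨?_, ?_⟩, hl, hr⟩
    · obtain ⟨s, hs⟩ := ne
      exact hs.1.1.trans_le (le_csSup bdd hs)
    · by_contra hcon
      push Not at hcon
      have hS' : ∀ s ∈ Ioo p h₁, e s / g s < c := fun s hs =>
        hl s ⟨hs.1, by linarith [hs.2]⟩ (hs.2.trans_le hcon)
      have := setIntegral_pos_of_pos_left
        (k := fun s => -(e s * √(2 * (h₁ - s)) - c * (g s * √(2 * (h₁ - s)))))
        hp (by linarith) ?_ ?_ iz.neg
      · rw [integral_neg, hz] at this
        simp at this
      · intro s hs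
        have hs' : s ∈ Ioo p q := ⟨hs.1, by linarith [hs.2]⟩
        have := mul_pos (mul_pos (sub_pos.2 (hS' s hs)) (hg s hs')) (K₁ s hs.2)
        rw [he s hs']; linarith
      · intro s hs
        rcases lt_or_ge s h₁ with h | h
        · have := mul_pos (mul_pos (sub_pos.2 (hS' s ⟨hs.1, h⟩)) (hg s hs)) (K₁ s h)
          rw [he s hs]; linarith
        · rw [Real.sqrt_eq_zero'.2 (by linarith : 2 * (h₁ - s) ≤ 0)]; simp
  set r := √(2 * (h₂ - t)) / √(2 * (h₁ - t)) with hr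
  have hr0 : r = √((h₂ - t) / (h₁ - t)) := by
    rw [hr, ← Real.sqrt_div' _ (by linarith [ht.2])]
    congr 1
    rw [mul_div_mul_left _ _ two_ne_zero]
  have hlt : ∀ s, s < t → √(2 * (h₂ - s)) < r * √(2 * (h₁ - s)) := by
    intro s hs
    have h1 : 0 < h₁ - t := by linarith [ht.2]
    rw [hr0, ← Real.sqrt_mul (div_nonneg (by linarith) h1.le)]
    apply Real.sqrt_lt_sqrt (by linarith)
    rw [div_mul_eq_mul_div, lt_div_iff₀ h1]
    nlinarith
  have hgt : ∀ s, t < s → s < h₂ → r * √(2 * (h₁ - s)) < √(2 * (h₂ - s)) := by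
    intro s hs hs2
    have h1 : 0 < h₁ - t := by linarith [ht.2]
    rw [hr0, ← Real.sqrt_mul (div_nonneg (by linarith) h1.le)]
    apply (Real.sqrt_lt_sqrt_iff_of_pos (by linarith)).2
    rw [div_mul_eq_mul_div, div_lt_iff₀ h1]
    nlinarith
  have i₂ : IntegrableOn (fun s => e s * √(2 * (h₂ - s)) - c * (g s * √(2 * (h₂ - s))))
    (Ioo p q) := ie₂.sub (ig₂.const_mul c)
  have hfac : ∀ s ∈ Ioo p q, (e s * √(2 * (h₂ - s)) - c * (g s * √(2 * (h₂ - s)))) -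
      r * (e s * √(2 * (h₁ - s)) - c * (g s * √(2 * (h₁ - s)))) =
      (e s / g s - c) * (√(2 * (h₂ - s)) - r * √(2 * (h₁ - s))) * g s := fun s hs => by
    nth_rw 1 2 [he s hs]; ring
  have hnn : ∀ s ∈ Ioo p q, s ≠ t → s < h₂ →
      0 < (e s / g s - c) * (√(2 * (h₂ - s)) - r * √(2 * (h₁ - s))) * g s := by
    intro s hs hst hs2
    refine mul_pos ?_ (hg s hs)
    rcases lt_or_gt_of_ne hst with h | h
    · exact mul_pos_of_neg_of_neg (sub_neg.2 (htl s hs h)) (sub_neg.2 (hlt s h))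
    · exact mul_pos (sub_pos.2 (htr s hs h)) (sub_pos.2 (hgt s h hs2))
  have hfin : 0 < ∫ s in Ioo p q, ((e s * √(2 * (h₂ - s)) - c * (g s * √(2 * (h₂ - s)))) -
      r * (e s * √(2 * (h₁ - s)) - c * (g s * √(2 * (h₁ - s))))) := by
    refine setIntegral_pos_of_pos_left ht.1 (by linarith [ht.2]) (fun s hs => ?_) (fun s hs => ?_)
      (i₂.sub (iz.const_mul r))
    · have hs' : s ∈ Ioo p q := ⟨hs.1, by linarith [hs.2, ht.2]⟩
      exact (hnn s hs' hs.2.ne (by linarith [hs.2, ht.2])).trans_eq (hfac s hs').symm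
    · refine le_of_le_of_eq ?_ (hfac s hs).symm
      by_cases hst : s = t
      · subst hst
        have : r * √(2 * (h₁ - s)) = √(2 * (h₂ - s)) := div_mul_cancel₀ _ (K₁ s ht.2).ne'
        rw [this]; simp
      · rcases lt_or_ge s h₂ with h | h
        · exact (hnn s hs hst h).le
        · rw [Real.sqrt_eq_zero'.2 (by linarith : 2 * (h₁ - s) ≤ 0),
            Real.sqrt_eq_zero'.2 (by linarith : 2 * (h₂ - s) ≤ 0)]
          simp
  rw [integral_sub i₂ (iz.const_mul r), integral_const_mul, hz, mul_zero, sub_zero,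
    integral_sub ie₂ (ig₂.const_mul c), integral_const_mul] at hfin
  rw [lt_div_iff₀ hpos₂]
  linarith

/-- Change of variables `s = Φ u` on an interval where `Φ` is a bijection with inverse `γ`. -/
theorem integral_comp_eq_integral_inverse {Φ Φ' γ f k : ℝ → ℝ} {l r p q : ℝ}
    (hd : ∀ u ∈ Ioo l r, HasDerivAt Φ (Φ' u) u) (hinj : InjOn Φ (Ioo l r))
    (hmaps : MapsTo Φ (Ioo l r) (Ioo p q))
    (hγ : ∀ s ∈ Ioo p q, γ s ∈ Ioo l r ∧ Φ (γ s) = s)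
    (hne : ∀ u ∈ Ioo l r, Φ' u ≠ 0)
    (hint : IntegrableOn (fun u => f u * k (Φ u)) (Ioo l r)) :
    IntegrableOn (fun s => f (γ s) / |Φ' (γ s)| * k s) (Ioo p q) ∧
      ∫ s in Ioo p q, f (γ s) / |Φ' (γ s)| * k s = ∫ u in Ioo l r, f u * k (Φ u) := by
  have himg : Φ '' Ioo l r = Ioo p q :=
    Subset.antisymm hmaps.image_subset fun s hs => ⟨γ s, hγ s hs⟩
  have hd' : ∀ u ∈ Ioo l r, HasDerivWithinAt Φ (Φ' u) (Ioo l r) u :=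
    fun u hu => (hd u hu).hasDerivWithinAt
  have hcongr : ∀ u ∈ Ioo l r,
      |Φ' u| • (f (γ (Φ u)) / |Φ' (γ (Φ u))| * k (Φ u)) = f u * k (Φ u) := by
    intro u hu
    have h := hγ _ (hmaps hu)
    rw [hinj h.1 hu h.2, smul_eq_mul]
    have := abs_ne_zero.2 (hne u hu)
    field_simp
  rw [← himg, integrableOn_image_iff_integrableOn_abs_deriv_smul measurableSet_Ioo hd' hinj,
    integral_image_eq_integral_abs_deriv_smul measurableSet_Ioo hd' hinj]
  exact ⟨hint.congr_fun (fun u hu => (hcongr u hu).symm) measurableSet_Ioo,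
    setIntegral_congr_fun measurableSet_Ioo hcongr⟩

/-- The potential `-u²/2 + u^(n+2)/((n+1)(n+2))`. -/
noncomputable def potential (n : ℕ) (u : ℝ) : ℝ :=
  -u ^ 2 / 2 + u ^ (n + 2) / (((n : ℝ) + 1) * ((n : ℝ) + 2))

theorem hasDerivAt_potential (n : ℕ) (u : ℝ) :
    HasDerivAt (potential n) (u * (u ^ n - (n + 1)) / (n + 1)) u := by
  have h := (((hasDerivAt_id u).pow 2).neg.div_const 2).add
    (((hasDerivAt_id u).pow (n + 2)).div_const (((n : ℝ) + 1) * ((n : ℝ) + 2)))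
  refine (h.congr_of_eventuallyEq (Filter.Eventually.of_forall fun x => ?_)).congr_deriv ?_
  · simp [potential]
  · have h1 : (n : ℝ) + 1 ≠ 0 := by positivity
    have h2 : (n : ℝ) + 2 ≠ 0 := by positivity
    simp only [id, Nat.cast_add, Nat.cast_ofNat,
      show n + 2 - 1 = n + 1 by omega, pow_succ]
    field_simp
    ring

theorem continuous_potential (n : ℕ) : Continuous (potential n) := by
  unfold potential
  fun_prop

section Wave

variable {n : ℕ} {a B : ℝ}

theorem strictAntiOn_potential (hn : n ≠ 0) (ha : a ^ n = (n : ℝ) + 1) :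
    StrictAntiOn (potential n) (Icc 0 a) := by
  refine strictAntiOn_of_deriv_neg (convex_Icc 0 a) (continuous_potential n).continuousOn ?_
  intro u hu
  rw [interior_Icc] at hu
  rw [(hasDerivAt_potential n u).deriv]
  have h1 := pow_lt_pow_left₀ hu.2 hu.1.le hn
  exact div_neg_of_neg_of_pos (mul_neg_of_pos_of_neg hu.1 (by linarith)) (by positivity)

theorem strictMonoOn_potential (hn : n ≠ 0) (ha0 : 0 < a) (ha : a ^ n = (n : ℝ) + 1) :
    StrictMonoOn (potential n) (Ici a) := by
  refine strictMonoOn_of_deriv_pos (convex_Ici a) (continuous_potential n).continuousOn ?_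
  intro u hu
  rw [interior_Ici] at hu
  rw [(hasDerivAt_potential n u).deriv]
  have h1 := pow_lt_pow_left₀ hu ha0.le hn
  exact div_pos (mul_pos (ha0.trans hu) (by linarith)) (by positivity)

theorem potential_zero (n : ℕ) : potential n 0 = 0 := by simp [potential]

theorem potential_eq_zero (hB : B ^ n = ((n : ℝ) + 1) * (n + 2) / 2) : potential n B = 0 := by
  have h1 : (n : ℝ) + 1 ≠ 0 := by positivity
  have h2 : (n : ℝ) + 2 ≠ 0 := by positivity
  rw [potential, pow_add, hB]
  field_simp
  ring

/-- The relation between the moments of order `n` and `0` along the homoclinic orbit. -/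
theorem integral_homoclinic (hn : n ≠ 0) (hB0 : 0 < B)
    (hB : B ^ n = ((n : ℝ) + 1) * (n + 2) / 2) :
    (3 * (n : ℝ) + 4) * ∫ u in (0 : ℝ)..B, u ^ n * √(2 * (0 - potential n u)) =
      2 * (n + 1) * (n + 2) * ∫ u in (0 : ℝ)..B, √(2 * (0 - potential n u)) := by
  have h1 : (0 : ℝ) < (n : ℝ) + 1 := by positivity
  have h2 : (0 : ℝ) < (n : ℝ) + 2 := by positivity
  set k : ℝ := 2 / ((n + 1) * (n + 2)) with hk
  have hk0 : 0 < k := by positivity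
  have hkB : k * B ^ n = 1 := by rw [hB, hk]; field_simp
  have hsq : ∀ u ∈ Ioo 0 B, √(2 * (0 - potential n u)) = u * √(1 - k * u ^ n) := by
    intro u hu
    rw [← Real.sqrt_sq hu.1.le, ← Real.sqrt_mul (sq_nonneg u), Real.sqrt_sq hu.1.le]
    congr 1
    rw [potential, hk, pow_add]
    field_simp
    ring
  have hw : ∀ u ∈ Ioo 0 B, 0 < 1 - k * u ^ n := by
    intro u hu
    rw [← hkB, ← mul_sub]
    exact mul_pos hk0 (sub_pos.2 (pow_lt_pow_left₀ hu.2 hu.1.le hn))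
  have hc := continuous_potential n
  have hFTC : ∫ u in (0 : ℝ)..B, (2 * √(2 * (0 - potential n u)) -
      k * (2 + 3 * n / 2) * (u ^ n * √(2 * (0 - potential n u)))) =
      B ^ 2 * ((1 - k * B ^ n) * √(1 - k * B ^ n)) -
        0 ^ 2 * ((1 - k * 0 ^ n) * √(1 - k * 0 ^ n)) := by
    refine intervalIntegral.integral_eq_sub_of_hasDerivAt_of_le
      (f := fun u => u ^ 2 * ((1 - k * u ^ n) * √(1 - k * u ^ n))) hB0.le
      (by fun_prop) (fun u hu => ?_) (Continuous.intervalIntegrable (by fun_prop) _ _)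
    have hwu := hw u hu
    have hd : HasDerivAt (fun u => 1 - k * u ^ n) (-(k * (n * u ^ (n - 1)))) u :=
      ((hasDerivAt_pow n u).const_mul k).const_sub 1
    refine ((hasDerivAt_pow 2 u).mul (hd.mul (hd.sqrt hwu.ne'))).congr_deriv ?_
    rw [hsq u hu]
    simp only [Pi.mul_apply]
    obtain ⟨m, rfl⟩ := Nat.exists_eq_succ_of_ne_zero hn
    have hs := Real.sqrt_pos.2 hwu
    have hs2 := Real.sq_sqrt hwu.le
    set S := √(1 - k * u ^ (m.succ)) with hS
    have : 1 - k * u ^ m.succ = S ^ 2 := hs2.symm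
    rw [this]
    field_simp
    have h3 : k * u ^ m.succ = 1 - S ^ 2 := by linarith
    simp only [Nat.succ_eq_add_one, Nat.add_sub_cancel, pow_succ u m] at h3 ⊢
    push_cast
    linear_combination 4 * u * h3
  rw [hkB, intervalIntegral.integral_sub (Continuous.intervalIntegrable (by fun_prop) _ _)
    (Continuous.intervalIntegrable (by fun_prop) _ _), intervalIntegral.integral_const_mul,
    intervalIntegral.integral_const_mul] at hFTC
  have h3 : k * ((n + 1) * (n + 2)) = 2 := by rw [hk]; field_simp
  simp only [sub_self, zero_mul, mul_zero, ne_eq, OfNat.ofNat_ne_zero, not_false_eq_true,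
    zero_pow] at hFTC
  linear_combination (-((n : ℝ) + 1) * (n + 2)) * hFTC -
    (2 + 3 * n / 2) * (∫ u in (0 : ℝ)..B, u ^ n * √(2 * (0 - potential n u))) * h3

/-- The integral over an oval, extended by the convention `√x = 0` for `x ≤ 0`. -/
theorem integral_oval_eq (hn : n ≠ 0) (ha0 : 0 < a) (ha : a ^ n = (n : ℝ) + 1) {h v w : ℝ}
    (hv : v ∈ Ioo 0 a) (hvh : potential n v = h) (hw : w ∈ Ioo a B)
    (hwh : potential n w = h) (f : ℝ → ℝ) :
    ∫ u in v..w, f u * √(2 * (h - potential n u)) =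
      ∫ u in Ioo 0 B, f u * √(2 * (h - potential n u)) := by
  have hvw : v ≤ w := (hv.2.trans hw.1).le
  rw [intervalIntegral.integral_of_le hvw]
  symm
  refine setIntegral_eq_of_subset_of_forall_sdiff_eq_zero measurableSet_Ioo
    (fun u hu => ⟨hv.1.trans hu.1, hu.2.trans_lt hw.2⟩) fun u hu => ?_
  have hle : h ≤ potential n u := by
    rcases le_or_gt u v with huv | huv
    · rw [← hvh]
      exact (strictAntiOn_potential hn ha).antitoneOn ⟨hu.1.1.le, huv.trans hv.2.le⟩
        ⟨hv.1.le, hv.2.le⟩ huv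
    · rw [← hwh]
      have hwu : w ≤ u := le_of_not_ge fun hc => hu.2 ⟨huv, hc⟩
      exact (strictMonoOn_potential hn ha0 ha).monotoneOn hw.1.le (hw.1.le.trans hwu) hwu
  rw [Real.sqrt_eq_zero'.2 (by linarith), mul_zero]

/-- Abelian integrals as integrals over the energy level, pairing both sides of the center. -/
theorem integral_eq_integral_energy (hn : n ≠ 0) (ha0 : 0 < a) (ha : a ^ n = (n : ℝ) + 1)
    (haB : a < B) (hB : B ^ n = ((n : ℝ) + 1) * (n + 2) / 2) {α β : ℝ → ℝ}
    (hα : ∀ h ∈ Ioo (potential n a) 0, α h ∈ Ioo 0 a ∧ potential n (α h) = h)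
    (hβ : ∀ h ∈ Ioo (potential n a) 0, β h ∈ Ioo a B ∧ potential n (β h) = h)
    {f : ℝ → ℝ} (hf : Continuous f) (h : ℝ) :
    IntegrableOn (fun s => (n + 1) * (f (α s) / (α s * (n + 1 - α s ^ n)) +
        f (β s) / (β s * (β s ^ n - (n + 1)))) * √(2 * (h - s))) (Ioo (potential n a) 0) ∧
      ∫ s in Ioo (potential n a) 0, (n + 1) * (f (α s) / (α s * (n + 1 - α s ^ n)) +
        f (β s) / (β s * (β s ^ n - (n + 1)))) * √(2 * (h - s)) =
      ∫ u in Ioo 0 B, f u * √(2 * (h - potential n u)) := by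
  have hc := continuous_potential n
  have hanti := strictAntiOn_potential hn ha
  have hmono := strictMonoOn_potential hn ha0 ha
  have hint : ∀ l r, IntegrableOn (fun u => f u * √(2 * (h - potential n u))) (Ioo l r) :=
    fun l r => (Continuous.integrableOn_Icc (by fun_prop)).mono_set Ioo_subset_Icc_self
  have hn1 : (0 : ℝ) < (n : ℝ) + 1 := by positivity
  have hlow : ∀ u ∈ Ioo 0 a, u ^ n < n + 1 := fun u hu =>
    ha ▸ pow_lt_pow_left₀ hu.2 hu.1.le hn
  have hhigh : ∀ u ∈ Ioo a B, n + 1 < u ^ n := fun u hu =>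
    ha ▸ pow_lt_pow_left₀ hu.1 ha0.le hn
  obtain ⟨i₁, e₁⟩ := integral_comp_eq_integral_inverse (k := fun s => √(2 * (h - s)))
    (f := f) (q := 0) (fun u _ => hasDerivAt_potential n u)
    (hanti.injOn.mono Ioo_subset_Icc_self)
    (fun u hu => ⟨hanti ⟨hu.1.le, hu.2.le⟩ (right_mem_Icc.2 ha0.le) hu.2,
      potential_zero n ▸ hanti (left_mem_Icc.2 ha0.le) ⟨hu.1.le, hu.2.le⟩ hu.1⟩)
    hα (fun u hu => (div_neg_of_neg_of_pos (mul_neg_of_pos_of_neg hu.1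
      (sub_neg.2 (hlow u hu))) hn1).ne) (hint 0 a)
  obtain ⟨i₂, e₂⟩ := integral_comp_eq_integral_inverse (k := fun s => √(2 * (h - s)))
    (f := f) (q := 0) (fun u _ => hasDerivAt_potential n u)
    (hmono.injOn.mono fun u hu => hu.1.le)
    (fun u hu => ⟨hmono self_mem_Ici hu.1.le hu.1,
      potential_eq_zero hB ▸ hmono hu.1.le haB.le hu.2⟩)
    hβ (fun u hu => (div_pos (mul_pos (ha0.trans hu.1)
      (sub_pos.2 (hhigh u hu))) hn1).ne') (hint a B)
  have hsum : ∫ u in Ioo 0 B, f u * √(2 * (h - potential n u)) =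
      (∫ u in Ioo 0 a, f u * √(2 * (h - potential n u))) +
        ∫ u in Ioo a B, f u * √(2 * (h - potential n u)) := by
    simp only [← integral_Ioc_eq_integral_Ioo]
    rw [← intervalIntegral.integral_of_le ha0.le, ← intervalIntegral.integral_of_le haB.le,
      ← intervalIntegral.integral_of_le (ha0.trans haB).le,
      intervalIntegral.integral_add_adjacent_intervals]
    all_goals exact Continuous.intervalIntegrable (by fun_prop) _ _
  have hcongr : ∀ s ∈ Ioo (potential n a) 0,
      f (α s) / |α s * (α s ^ n - (n + 1)) / (n + 1)| * √(2 * (h - s)) +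
        f (β s) / |β s * (β s ^ n - (n + 1)) / (n + 1)| * √(2 * (h - s)) =
      (n + 1) * (f (α s) / (α s * (n + 1 - α s ^ n)) +
        f (β s) / (β s * (β s ^ n - (n + 1)))) * √(2 * (h - s)) := by
    intro s hs
    have hv := (hα s hs).1
    have hw := (hβ s hs).1
    have hv' := hlow _ hv
    have hw' := hhigh _ hw
    rw [abs_of_neg (div_neg_of_neg_of_pos (mul_neg_of_pos_of_neg hv.1 (sub_neg.2 hv')) hn1),
      abs_of_pos (div_pos (mul_pos (ha0.trans hw.1) (sub_pos.2 hw')) hn1), ← add_mul]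
    congr 1
    have hr : -(α s * (α s ^ n - (n + 1)) / (n + 1)) = α s * (n + 1 - α s ^ n) / (n + 1) := by
      ring
    rw [hr, div_div_eq_mul_div, div_div_eq_mul_div]
    ring
  rw [hsum, ← e₁, ← e₂, ← integral_add i₁ i₂]
  exact ⟨(i₁.add i₂).congr_fun hcongr measurableSet_Ioo,
    (setIntegral_congr_fun measurableSet_Ioo hcongr).symm⟩

/-- The ratio of the energy densities of `n + 1 - u^n` and `1` is strictly increasing. -/
theorem density_ratio_lt {v w v' w' N : ℝ} (hn : n ≠ 0) (hv' : 0 < v') (hvv : v' < v)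
    (hvN : v ^ n < N) (hw0 : 0 < w) (hww : w < w') (hwN : N < w ^ n) :
    (1 / v - 1 / w) / (1 / (v * (N - v ^ n)) + 1 / (w * (w ^ n - N))) <
      (1 / v' - 1 / w') / (1 / (v' * (N - v' ^ n)) + 1 / (w' * (w' ^ n - N))) := by
  have hv0 := hv'.trans hvv
  have hw'0 := hw0.trans hww
  have hp : v' ^ n < v ^ n := pow_lt_pow_left₀ hvv hv'.le hn
  have hq : w ^ n < w' ^ n := pow_lt_pow_left₀ hww hw0.le hn
  have hvw : v < w := lt_of_pow_lt_pow_left₀ n hw0.le (hvN.trans hwN)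
  have key : ∀ x y : ℝ, 0 < x → x < y → x ^ n < N → N < y ^ n →
      0 < 1 / ((N - x ^ n) * (1 - x / y)) + 1 / ((y ^ n - N) * (y / x - 1)) ∧
      (1 / x - 1 / y) / (1 / (x * (N - x ^ n)) + 1 / (y * (y ^ n - N))) =
      1 / (1 / ((N - x ^ n) * (1 - x / y)) + 1 / ((y ^ n - N) * (y / x - 1))) := by
    intro x y hx hxy hxN hyN
    have hy := hx.trans hxy
    have h1 : 0 < N - x ^ n := by linarith
    have h2 : 0 < y ^ n - N := by linarith
    have h3 : 0 < y - x := by linarith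
    have e1 : 1 - x / y = (y - x) / y := by field_simp
    have e2 : y / x - 1 = (y - x) / x := by field_simp
    rw [e1, e2]
    refine ⟨by positivity, ?_⟩
    generalize N - x ^ n = P at *
    generalize y ^ n - N = Q at *
    have e3 : 1 / x - 1 / y = (y - x) / (x * y) := by field_simp
    have h4 : 0 < y * Q + x * P := by positivity
    have e4 : 1 / (x * P) + 1 / (y * Q) = (y * Q + x * P) / (x * y * P * Q) := by
      field_simp
    have e5 : 1 / (P * ((y - x) / y)) + 1 / (Q * ((y - x) / x)) =
        (y * Q + x * P) / ((y - x) * P * Q) := by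
      field_simp
    rw [e3, e4, e5]
    field_simp
  obtain ⟨-, e₁⟩ := key v w hv0 hvw hvN hwN
  obtain ⟨p₂, e₂⟩ := key v' w' hv' (by linarith) (by linarith) (by linarith)
  rw [e₁, e₂]
  apply one_div_lt_one_div_of_lt p₂
  have h1 : v / w < 1 := (div_lt_one hw0).2 hvw
  have h2 : 1 < w / v := (one_lt_div hv0).2 hvw
  have h3 : v' / w' < v / w := div_lt_div₀ hvv hww.le hv0.le hw0
  have h4 : w / v < w' / v' := div_lt_div₀ hww hvv.le hw'0.le hv'
  refine add_lt_add (one_div_lt_one_div_of_lt ?_ ?_) (one_div_lt_one_div_of_lt ?_ ?_)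
  · exact mul_pos (by linarith) (by linarith)
  · exact mul_lt_mul'' (by linarith) (by linarith) (by linarith) (by linarith)
  · exact mul_pos (by linarith) (by linarith)
  · exact mul_lt_mul'' (by linarith) (by linarith) (by linarith) (by linarith)

end Wave

end Lemmas


theorem stmt_19 (n : ℕ) (hn : 1 ≤ n) (Φ : ℝ → ℝ)
    (hΦ : ∀ u : ℝ, Φ u = -u ^ 2 / 2 + u ^ (n + 2) / (((n : ℝ) + 1) * ((n : ℝ) + 2)))
    (a B p₁ : ℝ) (ha : a = ((n : ℝ) + 1) ^ ((1 : ℝ) / n))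
    (hB : B = (((n : ℝ) + 1) * ((n : ℝ) + 2) / 2) ^ ((1 : ℝ) / n))
    (hp₁ : p₁ = -(n : ℝ) * ((n : ℝ) + 1) ^ ((2 : ℝ) / n) / (2 * ((n : ℝ) + 2)))
    (α β : ℝ → ℝ)
    (hα : ∀ h ∈ Set.Ioo p₁ (0 : ℝ), α h ∈ Set.Ioo (0 : ℝ) a ∧ Φ (α h) = h)
    (hβ : ∀ h ∈ Set.Ioo p₁ (0 : ℝ), β h ∈ Set.Ioo a B ∧ Φ (β h) = h)
    (A : ℕ → ℝ → ℝ)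
    (hA : ∀ (m : ℕ) (h : ℝ),
      A m h = 2 * ∫ u in (α h)..(β h), u ^ m * Real.sqrt (2 * (h - Φ u)))
    (c₀ : ℝ → ℝ)
    (hc₀ : ∀ h ∈ Set.Ioo p₁ (0 : ℝ), c₀ h = 1 / (A n h / A 0 h - 1)) :
    (∀ h ∈ Set.Ioo p₁ (0 : ℝ), 1 < A n h / A 0 h) ∧
    StrictMonoOn c₀ (Set.Ioo p₁ 0) ∧
    (∀ h ∈ Set.Ioo p₁ (0 : ℝ),
      1 / (n : ℝ) < c₀ h ∧ c₀ h < (3 * (n : ℝ) + 4) / (2 * (n : ℝ) ^ 2 + 3 * (n : ℝ))) := by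
  have hn0 : n ≠ 0 := by omega
  have hnpos : (0 : ℝ) < n := by exact_mod_cast hn
  obtain rfl : Φ = potential n := funext hΦ
  have ha0 : 0 < a := ha ▸ Real.rpow_pos_of_pos (by positivity) _
  have han : a ^ n = (n : ℝ) + 1 := by
    rw [ha, ← Real.rpow_natCast, ← Real.rpow_mul (by positivity),
      one_div_mul_cancel hnpos.ne', Real.rpow_one]
  have hB0 : 0 < B := hB ▸ Real.rpow_pos_of_pos (by positivity) _
  have hBn : B ^ n = ((n : ℝ) + 1) * (n + 2) / 2 := by
    rw [hB, ← Real.rpow_natCast, ← Real.rpow_mul (by positivity),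
      one_div_mul_cancel hnpos.ne', Real.rpow_one]
  have haB : a < B := by
    refine lt_of_pow_lt_pow_left₀ n hB0.le ?_
    rw [han, hBn]
    nlinarith
  have hpa : p₁ = potential n a := by
    have h2 : a ^ 2 = ((n : ℝ) + 1) ^ ((2 : ℝ) / n) := by
      rw [ha, ← Real.rpow_natCast, ← Real.rpow_mul (by positivity)]
      congr 1
      push_cast
      ring
    rw [hp₁, ← h2, potential, pow_add, han]
    field_simp
    ring
  subst hpa
  have hlow : ∀ s ∈ Set.Ioo (potential n a) 0, α s ^ n < n + 1 := fun s hs =>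
    han ▸ pow_lt_pow_left₀ (hα s hs).1.2 (hα s hs).1.1.le hn0
  have hhigh : ∀ s ∈ Set.Ioo (potential n a) 0, n + 1 < β s ^ n := fun s hs =>
    han ▸ pow_lt_pow_left₀ (hβ s hs).1.1 ha0.le hn0
  let f : ℝ → ℝ := fun u => (n : ℝ) + 1 - u ^ n
  have hc := continuous_potential n
  have ig := integral_eq_integral_energy hn0 ha0 han haB hBn hα hβ
    (f := fun _ => 1) continuous_const
  have ie := integral_eq_integral_energy hn0 ha0 han haB hBn hα hβ
    (f := f) (by fun_prop)
  let g : ℝ → ℝ := fun s => (n + 1) * (1 / (α s * (n + 1 - α s ^ n)) +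
    1 / (β s * (β s ^ n - (n + 1))))
  let e : ℝ → ℝ := fun s => (n + 1) * (f (α s) / (α s * (n + 1 - α s ^ n)) +
    f (β s) / (β s * (β s ^ n - (n + 1))))
  have hg : ∀ s ∈ Set.Ioo (potential n a) 0, 0 < g s := by
    intro s hs
    have h1 := sub_pos.2 (hlow s hs)
    have h2 := sub_pos.2 (hhigh s hs)
    have h3 := (hα s hs).1.1
    have h4 := ha0.trans (hβ s hs).1.1
    positivity
  have he : ∀ s ∈ Set.Ioo (potential n a) 0, e s = (n + 1) * (1 / α s - 1 / β s) := by
    intro s hs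
    have h1 := (sub_pos.2 (hlow s hs)).ne'
    have h2 := (sub_pos.2 (hhigh s hs)).ne'
    have h3 := (hα s hs).1.1.ne'
    have h4 := (ha0.trans (hβ s hs).1.1).ne'
    have h5 : f (α s) / (α s * (n + 1 - α s ^ n)) = 1 / α s := by
      simp only [f]; field_simp
    have h6 : f (β s) / (β s * (β s ^ n - (n + 1))) = -(1 / β s) := by
      simp only [f]
      rw [← neg_sub (β s ^ n)]
      field_simp
    simp only [e, h5, h6]
    ring
  have hepos : ∀ s ∈ Set.Ioo (potential n a) 0, 0 < e s := by
    intro s hs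
    rw [he s hs]
    have := one_div_lt_one_div_of_lt (hα s hs).1.1 ((hα s hs).1.2.trans (hβ s hs).1.1)
    exact mul_pos (by positivity) (sub_pos.2 this)
  have hmono : StrictMonoOn (fun s => e s / g s) (Set.Ioo (potential n a) 0) := by
    intro s hs t ht hst
    have hst' : potential n (α t) > potential n (α s) := by rwa [(hα s hs).2, (hα t ht).2]
    have hst'' : potential n (β s) < potential n (β t) := by rwa [(hβ s hs).2, (hβ t ht).2]
    have h1 : α t < α s := ((strictAntiOn_potential hn0 han).lt_iff_gt
      ⟨(hα s hs).1.1.le, (hα s hs).1.2.le⟩ ⟨(hα t ht).1.1.le, (hα t ht).1.2.le⟩).1 hst'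
    have h2 : β s < β t := ((strictMonoOn_potential hn0 ha0 han).lt_iff_lt
      (hβ s hs).1.1.le (hβ t ht).1.1.le).1 hst''
    simp only [he s hs, he t ht, g]
    rw [mul_div_mul_left _ _ (by positivity), mul_div_mul_left _ _ (by positivity)]
    exact density_ratio_lt hn0 (hα t ht).1.1 h1 (hlow s hs) (ha0.trans (hβ s hs).1.1) h2
      (hhigh s hs)
  let E : ℝ → ℝ := fun h => ∫ u in Set.Ioo 0 B, f u * √(2 * (h - potential n u))
  let F : ℝ → ℝ := fun h => ∫ u in Set.Ioo 0 B, 1 * √(2 * (h - potential n u))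
  have hlt : ∀ h₁ h₂, potential n a < h₁ → h₁ < h₂ → h₂ ≤ 0 → E h₁ / F h₁ < E h₂ / F h₂ := by
    intro h₁ h₂ hp h₁₂ hq
    have := ratio_lt_of_strictMonoOn hp h₁₂ hq hg hmono (ie h₁).1 (ie h₂).1 (ig h₁).1 (ig h₂).1
    rwa [(ie h₁).2, (ie h₂).2, (ig h₁).2, (ig h₂).2] at this
  have hpos : ∀ k : ℝ → ℝ, (∀ s ∈ Set.Ioo (potential n a) 0, 0 < k s) → ∀ h,
      potential n a < h → h ≤ 0 →
      IntegrableOn (fun s => k s * √(2 * (h - s))) (Set.Ioo (potential n a) 0) →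
      0 < ∫ s in Set.Ioo (potential n a) 0, k s * √(2 * (h - s)) := fun k hk h hh hh0 ik =>
    setIntegral_pos_of_pos_left hh hh0
      (fun s hs => mul_pos (hk s ⟨hs.1, hs.2.trans_le hh0⟩)
        (Real.sqrt_pos.2 (by linarith [hs.2])))
      (fun s hs => mul_nonneg (hk s hs).le (Real.sqrt_nonneg _)) ik
  have hF : ∀ h, potential n a < h → h ≤ 0 → 0 < F h := fun h hh hh0 =>
    (hpos g hg h hh hh0 (ig h).1).trans_eq (ig h).2
  have hE : ∀ h, potential n a < h → h ≤ 0 → 0 < E h := fun h hh hh0 =>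
    (hpos e hepos h hh hh0 (ie h).1).trans_eq (ie h).2
  have hEF : ∀ h, E h = (n + 1) * F h -
      ∫ u in Set.Ioo 0 B, u ^ n * √(2 * (h - potential n u)) := by
    intro h
    have i : ∀ k : ℝ → ℝ, Continuous k → IntegrableOn k (Set.Ioo 0 B) := fun k hk =>
      hk.integrableOn_Icc.mono_set Set.Ioo_subset_Icc_self
    simp only [E, F, f]
    rw [← integral_const_mul, ← integral_sub (i _ (by fun_prop)) (i _ (by fun_prop))]
    congr 1
    ext u
    ring
  have hp0 : potential n a < 0 := potential_zero n ▸
    strictAntiOn_potential hn0 han (Set.left_mem_Icc.2 ha0.le) (Set.right_mem_Icc.2 ha0.le) ha0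
  have hE0 : E 0 / F 0 = n * (n + 1) / (3 * n + 4) := by
    have h := integral_homoclinic hn0 hB0 hBn
    rw [intervalIntegral.integral_of_le hB0.le, intervalIntegral.integral_of_le hB0.le,
      integral_Ioc_eq_integral_Ioo, integral_Ioc_eq_integral_Ioo] at h
    have hF0 : F 0 = ∫ u in Set.Ioo 0 B, √(2 * (0 - potential n u)) := by simp only [F, one_mul]
    rw [← hF0] at h
    rw [div_eq_div_iff (hF 0 hp0 le_rfl).ne' (by positivity), hEF]
    linear_combination -h
  have hR : ∀ h ∈ Set.Ioo (potential n a) 0, A n h / A 0 h = n + 1 - E h / F h := by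
    intro h hh
    have hfn := integral_oval_eq hn0 ha0 han (hα h hh).1 (hα h hh).2 (hβ h hh).1 (hβ h hh).2
    have hFh := (hF h hh.1 hh.2.le).ne'
    rw [hA, hA, hfn (fun u => u ^ n), hfn (fun u => u ^ 0), mul_div_mul_left _ _ two_ne_zero]
    have h0 : ∫ u in Set.Ioo 0 B, u ^ 0 * √(2 * (h - potential n u)) = F h := by
      simp only [F, pow_zero]
    rw [h0, hEF]
    field_simp
    ring
  have hbound : ∀ h ∈ Set.Ioo (potential n a) 0, E h / F h < n * (n + 1) / (3 * n + 4) :=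
    fun h hh => hE0 ▸ hlt h 0 hh.1 hh.2 le_rfl
  have hbn : (n : ℝ) * (n + 1) / (3 * n + 4) < n := by
    rw [div_lt_iff₀ (by positivity)]
    nlinarith
  have hc' : ∀ h ∈ Set.Ioo (potential n a) 0, c₀ h = 1 / (n - E h / F h) := fun h hh => by
    rw [hc₀ h hh, hR h hh]
    congr 1
    ring
  refine ⟨fun h hh => ?_, fun s hs t ht hst => ?_, fun h hh => ?_⟩
  · rw [hR h hh]
    linarith [hbound h hh]
  · rw [hc' s hs, hc' t ht]
    exact one_div_lt_one_div_of_lt (by linarith [hbound t ht])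
      (by linarith [hlt s t hs.1 hst ht.2.le])
  · rw [hc' h hh]
    have h1 := div_pos (hE h hh.1 hh.2.le) (hF h hh.1 hh.2.le)
    have h2 := hbound h hh
    refine ⟨one_div_lt_one_div_of_lt (by linarith) (by linarith), ?_⟩
    have h3 : (3 * (n : ℝ) + 4) / (2 * (n : ℝ) ^ 2 + 3 * (n : ℝ)) =
        1 / (n - n * (n + 1) / (3 * n + 4)) := by
      have h4 : (n : ℝ) - n * (n + 1) / (3 * n + 4) = (2 * n ^ 2 + 3 * n) / (3 * n + 4) := by
        field_simp
        ring
      rw [h4, one_div_div]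
    rw [h3]
    exact one_div_lt_one_div_of_lt (by linarith) (by linarith)
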